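/- Let G be a graph with vertex set 𝒱 = {ν_1,…,ν_N} and let k be an integer with 1 ≤ k ≤ N+1. Let E be any election obtained by the positive-cost Fallback construction for (G,k). Then for every subset S ⊆ 𝒱 with |S| = k: the candidate p is a Fallback winner (equivalently, a simplified Fallback winner) of the election obtained from E by increasing the approval count of the voter x_i to rank(p,x_i) for every ν_i ∈ S (so that x_i approves exactly (𝒱∖N[ν_i]) ∪ {b,p}) and leaving all other votes unchanged, if and only if S is a dominating set of G. -/

import Mathlib

section Fallback

variable {C W : Type*} [Fintype W]

/-- Voters who approve `c` and rank `c` in their top `k` positions. -/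
def fbApproversAt (rank : W → C → ℕ) (ℓcnt : W → ℕ) (k : ℕ) (c : C) : Finset W :=
  Finset.univ.filter (fun w => rank w c ≤ k ∧ rank w c ≤ ℓcnt w)

/-- The approval score of `c`: the number of voters approving `c`. -/
def fbApprovalScore (rank : W → C → ℕ) (ℓcnt : W → ℕ) (c : C) : ℕ :=
  (Finset.univ.filter (fun w => rank w c ≤ ℓcnt w)).card

/-- `c` reaches majority at round `k`. -/
def fbMajAt (rank : W → C → ℕ) (ℓcnt : W → ℕ) (k : ℕ) (c : C) : Prop :=
  Fintype.card W / 2 + 1 ≤ (fbApproversAt rank ℓcnt k c).card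

/-- `c` is a Fallback winner. -/
def IsFallbackWinner (rank : W → C → ℕ) (ℓcnt : W → ℕ) (c : C) : Prop :=
  (∃ kB, IsLeast {k : ℕ | ∃ c' : C, fbMajAt rank ℓcnt k c'} kB ∧
      ∀ c' : C, (fbApproversAt rank ℓcnt kB c').card ≤ (fbApproversAt rank ℓcnt kB c).card) ∨
  ((¬ ∃ k : ℕ, ∃ c' : C, fbMajAt rank ℓcnt k c') ∧
      ∀ c' : C, fbApprovalScore rank ℓcnt c' ≤ fbApprovalScore rank ℓcnt c)

/-- `c` is a simplified Fallback winner. -/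
def IsSimpFallbackWinner (rank : W → C → ℕ) (ℓcnt : W → ℕ) (c : C) : Prop :=
  (∃ kB, IsLeast {k : ℕ | ∃ c' : C, fbMajAt rank ℓcnt k c'} kB ∧ fbMajAt rank ℓcnt kB c) ∨
  ((¬ ∃ k : ℕ, ∃ c' : C, fbMajAt rank ℓcnt k c') ∧
      ∀ c' : C, fbApprovalScore rank ℓcnt c' ≤ fbApprovalScore rank ℓcnt c)

end Fallback

/-- The closed neighborhood of a vertex, as a finset. -/
def closedNbhd {V : Type*} [Fintype V] [DecidableEq V] (G : SimpleGraph V)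
    [DecidableRel G.Adj] (v : V) : Finset V :=
  insert v (G.neighborFinset v)

/-- The voters of the positive-cost Fallback construction: the voters `x_i` (`i ∈ 𝒱`),
`k` voters, one voter, and `N+1−k` voters. -/
abbrev PosVoter (V : Type*) (N k : ℕ) := V ⊕ (Fin k ⊕ (Fin 1 ⊕ Fin (N + 1 - k)))

/-- The voter `x_i` of the positive-cost construction. -/
def posX {V : Type*} (N k : ℕ) (i : V) : PosVoter V N k := Sum.inl i

/-- One of the `k` voters approving only `a`. -/
def posY1 {V : Type*} (N k : ℕ) (j : Fin k) : PosVoter V N k := Sum.inr (Sum.inl j)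

/-- The single voter approving exactly `𝒱`. -/
def posY2 {V : Type*} (N k : ℕ) (j : Fin 1) : PosVoter V N k := Sum.inr (Sum.inr (Sum.inl j))

/-- One of the `N+1−k` voters `a ≻ b ≻ p ≻ 𝒱 |`. -/
def posY3 {V : Type*} (N k : ℕ) (j : Fin (N + 1 - k)) : PosVoter V N k :=
  Sum.inr (Sum.inr (Sum.inr j))

section Fallback

variable {C W : Type*} [Fintype W] {rank : W → C → ℕ} {ℓ : W → ℕ}

theorem card_fbApproversAt_le (k : ℕ) (c : C) :
    (fbApproversAt rank ℓ k c).card ≤ fbApprovalScore rank ℓ c :=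
  Finset.card_le_card (Finset.monotone_filter_right _ fun _ _ h => h.2)

/-- Some candidate reaches majority at some round iff some approval score is a majority. -/
theorem exists_fbMajAt_iff :
    (∃ k : ℕ, ∃ c : C, fbMajAt rank ℓ k c) ↔
      ∃ c : C, Fintype.card W / 2 < fbApprovalScore rank ℓ c := by
  constructor
  · rintro ⟨k, c, h⟩
    exact ⟨c, h.trans (card_fbApproversAt_le k c)⟩
  · rintro ⟨c, h⟩
    refine ⟨∑ w, rank w c, c, le_trans (Nat.succ_le_of_lt h) (Finset.card_le_card ?_)⟩
    intro w hw
    simp only [fbApproversAt, Finset.mem_filter, Finset.mem_univ, true_and] at hw ⊢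
    exact ⟨Finset.single_le_sum (f := fun w => rank w c) (fun _ _ => Nat.zero_le _)
      (Finset.mem_univ w), hw⟩

/-- A candidate approved by exactly half of the voters (rounded down) wins iff nobody has a
majority of approvals. -/
theorem isSimpFallbackWinner_iff_of_score_eq {p : C}
    (hp : fbApprovalScore rank ℓ p = Fintype.card W / 2) :
    IsSimpFallbackWinner rank ℓ p ↔ ∀ c, fbApprovalScore rank ℓ c ≤ Fintype.card W / 2 := by
  constructor
  · rintro (⟨k, -, hk⟩ | ⟨-, h⟩)
    · have hk' := card_fbApproversAt_le (rank := rank) (ℓ := ℓ) k p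
      unfold fbMajAt at hk
      omega
    · exact hp ▸ h
  · intro h
    refine Or.inr ⟨?_, hp ▸ h⟩
    rw [exists_fbMajAt_iff]
    rintro ⟨c, hc⟩
    exact (h c).not_gt hc

/-- A candidate approved by exactly half of the voters (rounded down) is a Fallback winner iff it
is a simplified Fallback winner. -/
theorem isFallbackWinner_iff_isSimpFallbackWinner_of_score_eq {p : C}
    (hp : fbApprovalScore rank ℓ p = Fintype.card W / 2) :
    IsFallbackWinner rank ℓ p ↔ IsSimpFallbackWinner rank ℓ p := by
  refine or_congr_left ⟨?_, ?_⟩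
  · rintro ⟨k, hk, h⟩
    obtain ⟨c, hc⟩ := hk.1
    exact ⟨k, hk, le_trans hc (h c)⟩
  · rintro ⟨k, -, hk⟩
    have hk' := card_fbApproversAt_le (rank := rank) (ℓ := ℓ) k p
    unfold fbMajAt at hk
    omega

end Fallback

/-- If an injective `f` takes values in `{1, …, |V|}` on the range of an injective `ι : V → C`,
then its other positive values exceed `|V|`. -/
theorem card_lt_of_injective_of_forall_le {V C : Type*} [Fintype V] {f : C → ℕ} {ι : V → C}
    (hf : Function.Injective f) (hι : Function.Injective ι)
    (hle : ∀ v, f (ι v) ≤ Fintype.card V) (hpos : ∀ c, 1 ≤ f c) {c : C} (hc : ∀ v, ι v ≠ c) :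
    Fintype.card V < f c := by
  by_contra! h
  have himage : Finset.univ.image (f ∘ ι) = Finset.Icc 1 (Fintype.card V) := by
    refine Finset.eq_of_subset_of_card_le ?_ ?_
    · intro n hn
      obtain ⟨v, -, rfl⟩ := Finset.mem_image.1 hn
      exact Finset.mem_Icc.2 ⟨hpos _, hle v⟩
    · rw [Finset.card_image_of_injective _ (hf.comp hι)]
      simp
  have hmem : f c ∈ Finset.univ.image (f ∘ ι) := himage ▸ Finset.mem_Icc.2 ⟨hpos c, h⟩
  obtain ⟨v, -, hv⟩ := Finset.mem_image.1 hmem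
  exact hc v (hf hv)

/-- The approval score in the positive-cost construction, split by voter group. -/
theorem fbApprovalScore_posVoter {V C : Type*} [Fintype V] {N k : ℕ}
    (rank : PosVoter V N k → C → ℕ) (ℓ : PosVoter V N k → ℕ) (c : C) :
    fbApprovalScore rank ℓ c =
      (Finset.univ.filter fun i => rank (posX N k i) c ≤ ℓ (posX N k i)).card +
      ((Finset.univ.filter fun j => rank (posY1 N k j) c ≤ ℓ (posY1 N k j)).card +
      ((Finset.univ.filter fun j => rank (posY2 N k j) c ≤ ℓ (posY2 N k j)).card +
      (Finset.univ.filter fun j => rank (posY3 N k j) c ≤ ℓ (posY3 N k j)).card)) := by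
  simp only [fbApprovalScore, Finset.card_filter, Fintype.sum_sum_type]
  rfl

/-- in the positive-cost Fallback construction for `(G,k)`, for every set `S`
of `k` vertices, increasing the approval count of the voter `x_i` to `rank(p,x_i)` for
every `ν_i ∈ S` makes `p` a Fallback winner (equivalently, a simplified Fallback winner)
if and only if `S` is a dominating set of `G`. -/
theorem statement9 {V C : Type*} [Fintype V] [DecidableEq V] [Fintype C] [DecidableEq C]
    (G : SimpleGraph V) [DecidableRel G.Adj]
    (N k : ℕ) (hN : Fintype.card V = N) (hk1 : 1 ≤ k) (hkN : k ≤ N + 1)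
    (a b p : C) (ι : V → C)
    (hι : Function.Injective ι)
    (hab : a ≠ b) (hap : a ≠ p) (hbp : b ≠ p)
    (hιa : ∀ v, ι v ≠ a) (hιb : ∀ v, ι v ≠ b) (hιp : ∀ v, ι v ≠ p)
    (hcover : ∀ x : C, (∃ v, x = ι v) ∨ x = a ∨ x = b ∨ x = p)
    (hcardC : Fintype.card C = N + 3)
    (rank : PosVoter V N k → C → ℕ)
    (hinj : ∀ w, Function.Injective (rank w))
    (hrange : ∀ w x, 1 ≤ rank w x ∧ rank w x ≤ N + 3)
    (ℓcnt : PosVoter V N k → ℕ)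
    -- the voters `x_i : | 𝒱∖N[ν_i] ≻ b ≻ p ≻ a ≻ N[ν_i]` with approval count `0`
    (hx : ∀ i : V,
      (∀ v ∈ Finset.univ \ closedNbhd G i,
        rank (posX N k i) (ι v) ≤ (Finset.univ \ closedNbhd G i).card) ∧
      rank (posX N k i) b = (Finset.univ \ closedNbhd G i).card + 1 ∧
      rank (posX N k i) p = (Finset.univ \ closedNbhd G i).card + 2 ∧
      rank (posX N k i) a = (Finset.univ \ closedNbhd G i).card + 3 ∧
      (∀ v ∈ closedNbhd G i,
        (Finset.univ \ closedNbhd G i).card + 4 ≤ rank (posX N k i) (ι v)) ∧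
      ℓcnt (posX N k i) = 0)
    -- the `k` voters `a |`
    (h1 : ∀ j : Fin k, rank (posY1 N k j) a = 1 ∧ ℓcnt (posY1 N k j) = 1)
    -- the single voter `𝒱 |`
    (h2 : ∀ j : Fin 1,
      (∀ v : V, rank (posY2 N k j) (ι v) ≤ N) ∧ ℓcnt (posY2 N k j) = N)
    -- the `N+1−k` voters `a ≻ b ≻ p ≻ 𝒱 |`
    (h3 : ∀ j : Fin (N + 1 - k),
      rank (posY3 N k j) a = 1 ∧ rank (posY3 N k j) b = 2 ∧ rank (posY3 N k j) p = 3 ∧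
      (∀ v : V, 4 ≤ rank (posY3 N k j) (ι v)) ∧ ℓcnt (posY3 N k j) = N + 3)
    -- the bribed election: the approval count of `x_i` is raised to `rank(p,x_i)`
    -- for every `ν_i ∈ S`
    (S : Finset V) (hS : S.card = k)
    (ℓ' : PosVoter V N k → ℕ)
    (hℓ'S : ∀ i ∈ S, ℓ' (posX N k i) = rank (posX N k i) p)
    (hℓ'rest : ∀ w : PosVoter V N k, (∀ i ∈ S, w ≠ posX N k i) → ℓ' w = ℓcnt w) :
    (IsFallbackWinner rank ℓ' p ↔ ∀ v : V, ∃ s ∈ S, v ∈ closedNbhd G s) ∧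
    (IsSimpFallbackWinner rank ℓ' p ↔ ∀ v : V, ∃ s ∈ S, v ∈ closedNbhd G s) := by
  have hX : ∀ i c, rank (posX N k i) c ≤ ℓ' (posX N k i) ↔
      i ∈ S ∧ rank (posX N k i) c ≤ rank (posX N k i) p := by
    intro i c
    by_cases hi : i ∈ S
    · simp [hi, hℓ'S i hi]
    · have hℓ : ℓ' (posX N k i) = 0 := by
        rw [hℓ'rest (posX N k i) fun j hj h => hi ((Sum.inl_injective h : i = j) ▸ hj)]
        exact (hx i).2.2.2.2.2
      have := (hrange (posX N k i) c).1
      simp only [hi, hℓ, false_and, iff_false]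
      omega
  have hY1 : ∀ j c, rank (posY1 N k j) c ≤ ℓ' (posY1 N k j) ↔ c = a := by
    intro j c
    rw [hℓ'rest (posY1 N k j) fun _ _ => Sum.inr_ne_inl, (h1 j).2]
    constructor
    · intro h
      exact hinj _ ((h.antisymm (hrange _ c).1).trans (h1 j).1.symm)
    · rintro rfl
      exact (h1 j).1.le
  have hY2 : ∀ j c, rank (posY2 N k j) c ≤ ℓ' (posY2 N k j) ↔ ∃ v, ι v = c := by
    intro j c
    rw [hℓ'rest (posY2 N k j) fun _ _ => Sum.inr_ne_inl, (h2 j).2]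
    constructor
    · intro h
      by_contra! hc
      have := card_lt_of_injective_of_forall_le (hinj (posY2 N k j)) hι
        (fun v => hN ▸ (h2 j).1 v) (fun c => (hrange _ c).1) hc
      omega
    · rintro ⟨v, rfl⟩
      exact (h2 j).1 v
  have hY3 : ∀ j c, rank (posY3 N k j) c ≤ ℓ' (posY3 N k j) := by
    intro j c
    rw [hℓ'rest (posY3 N k j) fun _ _ => Sum.inr_ne_inl, (h3 j).2.2.2.2]
    exact (hrange _ c).2
  have hkN' : k ≤ N := hS ▸ hN ▸ S.card_le_univ
  have hhalf : Fintype.card (PosVoter V N k) / 2 = N + 1 := by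
    simp only [Fintype.card_sum, Fintype.card_fin, hN]
    omega
  have hXa : ∀ i, ¬ rank (posX N k i) a ≤ rank (posX N k i) p := by
    intro i
    obtain ⟨-, -, hp, ha, -⟩ := hx i
    omega
  have hXb : ∀ i, rank (posX N k i) b ≤ rank (posX N k i) p := by
    intro i
    obtain ⟨-, hb, hp, -⟩ := hx i
    omega
  have hXv : ∀ i v, rank (posX N k i) (ι v) ≤ rank (posX N k i) p ↔ v ∉ closedNbhd G i := by
    intro i v
    obtain ⟨hout, -, hp, -, hin, -⟩ := hx i
    by_cases hv : v ∈ closedNbhd G i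
    · have := hin v hv
      simp only [hv, not_true_eq_false, iff_false]
      omega
    · have := hout v (by simpa using hv)
      simp only [hv, not_false_eq_true, iff_true]
      omega
  have hscore_a : fbApprovalScore rank ℓ' a = N + 1 := by
    simp [fbApprovalScore_posVoter, hX, hY1, hY2, hY3, hXa, hιa]
    omega
  have hscore_b : fbApprovalScore rank ℓ' b = N + 1 := by
    simp [fbApprovalScore_posVoter, hX, hY1, hY2, hY3, hXb, hιb, hab.symm, hS]
    omega
  have hscore_p : fbApprovalScore rank ℓ' p = N + 1 := by
    simp [fbApprovalScore_posVoter, hX, hY1, hY2, hY3, hιp, hap.symm, hS]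
    omega
  have hscore_v : ∀ v, fbApprovalScore rank ℓ' (ι v) =
      (S.filter fun i => v ∉ closedNbhd G i).card + (1 + (N + 1 - k)) := by
    intro v
    simp [fbApprovalScore_posVoter, hX, hY1, hY2, hY3, hXv, hιa, Finset.filter_and,
      Finset.inter_filter]
  have hdom : ∀ v, fbApprovalScore rank ℓ' (ι v) ≤ N + 1 ↔ ∃ s ∈ S, v ∈ closedNbhd G s := by
    intro v
    have hlt : (S.filter fun i => v ∉ closedNbhd G i).card < S.card ↔
        ∃ s ∈ S, v ∈ closedNbhd G s := by
      rw [(Finset.card_filter_le _ _).lt_iff_ne, Ne, Finset.card_filter_eq_iff]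
      push Not
      rfl
    rw [← hlt, hscore_v, hS]
    omega
  have hhalf_p : fbApprovalScore rank ℓ' p = Fintype.card (PosVoter V N k) / 2 :=
    hscore_p.trans hhalf.symm
  have hsimp : IsSimpFallbackWinner rank ℓ' p ↔ ∀ v : V, ∃ s ∈ S, v ∈ closedNbhd G s := by
    rw [isSimpFallbackWinner_iff_of_score_eq hhalf_p, hhalf]
    simp only [← hdom]
    refine ⟨fun h v => h (ι v), fun h c => ?_⟩
    obtain ⟨v, rfl⟩ | rfl | rfl | rfl := hcover c
    exacts [h v, hscore_a.le, hscore_b.le, hscore_p.le]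
  exact ⟨(isFallbackWinner_iff_isSimpFallbackWinner_of_score_eq hhalf_p).trans hsimp, hsimp⟩
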